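/- arXiv:1103.2928 — 6 statements merged into one kernel-verified Lean document; each statement's English description precedes it below -/
import Mathlib

section
/- Let p, q be natural numbers, let γ be the (p+q)×(p+q) complex matrix given in block form by γ = diag(1_p, −1_q), and let J = U∘C be an antiunitary operator on ℂ^(p+q), where U is a unitary (p+q)×(p+q) complex matrix and C denotes entrywise complex conjugation. If J∘J = id and J∘γ = γ∘J (the case of KO-dimension 0, with signs ε = 1, ε'' = 1), then U is block diagonal: there exist a unitary p×p matrix j₊ and a unitary q×q matrix j₋, both symmetric (j₊ᵀ = j₊ and j₋ᵀ = j₋), such that U = diag(j₊, j₋). -/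
open Matrix

/-- Lemma 2.1, KO-dimension 0 case: if `J = U ∘ C` is an antiunitary on `ℂ^(p+q)`
(with `U` unitary and `C` entrywise conjugation) satisfying `J² = id` and `Jγ = γJ`
for the grading `γ = diag(1_p, -1_q)`, then `U = diag(j₊, j₋)` with `j₊, j₋`
symmetric unitary matrices. -/
theorem two_point_real_structure_KO_dim_zero (p q : ℕ)
    (U : Matrix (Fin p ⊕ Fin q) (Fin p ⊕ Fin q) ℂ)
    (hU : U ∈ Matrix.unitaryGroup (Fin p ⊕ Fin q) ℂ)
    (γ : Matrix (Fin p ⊕ Fin q) (Fin p ⊕ Fin q) ℂ)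
    (hγ : γ = Matrix.fromBlocks (1 : Matrix (Fin p) (Fin p) ℂ) 0 0
      (-1 : Matrix (Fin q) (Fin q) ℂ))
    (J : (Fin p ⊕ Fin q → ℂ) → (Fin p ⊕ Fin q → ℂ))
    (hJ : ∀ x, J x = U.mulVec (star x))
    (hJJ : ∀ x, J (J x) = x)
    (hJγ : ∀ x, J (γ.mulVec x) = γ.mulVec (J x)) :
    ∃ (jp : Matrix (Fin p) (Fin p) ℂ) (jm : Matrix (Fin q) (Fin q) ℂ),
      jp ∈ Matrix.unitaryGroup (Fin p) ℂ ∧ jm ∈ Matrix.unitaryGroup (Fin q) ℂ ∧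
      jp.transpose = jp ∧ jm.transpose = jm ∧
      U = Matrix.fromBlocks jp 0 0 jm := by
  have conj_mulVec : ∀ (M : Matrix (Fin p ⊕ Fin q) (Fin p ⊕ Fin q) ℂ) x,
      star (M *ᵥ x) = Mᴴᵀ *ᵥ star x := fun M x => by
    rw [star_mulVec, mulVec_transpose]
  have hUU : U * Uᴴᵀ = 1 := ext_of_mulVec_single fun i => by
    have h := hJJ (Pi.single i 1)
    rw [hJ, hJ, conj_mulVec, star_star, mulVec_mulVec] at h
    rw [h, one_mulVec]
  have hγγ : γᴴᵀ = γ := by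
    simp [hγ, fromBlocks_conjTranspose, fromBlocks_transpose]
  have hcomm : U * γ = γ * U := ext_of_mulVec_single fun i => by
    have h := hJγ (star (Pi.single i 1))
    rw [hJ, hJ, conj_mulVec, hγγ, star_star] at h
    simpa only [mulVec_mulVec] using h
  have hconj : Uᴴᵀ = Uᴴ :=
    (left_inv_eq_right_inv (mem_unitaryGroup_iff'.mp hU) hUU).symm
  have hsymm : Uᵀ = U := by
    have h := congrArg (fun M => Mᵀᴴ) hconj
    ext i j
    simpa using congrFun (congrFun h j) i
  have hUstar : U * Uᴴ = 1 := mem_unitaryGroup_iff.mp hU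
  obtain ⟨A, B, C, D, rfl⟩ : ∃ A B C D, U = fromBlocks A B C D :=
    ⟨_, _, _, _, (fromBlocks_toBlocks U).symm⟩
  rw [hγ, fromBlocks_multiply, fromBlocks_multiply, fromBlocks_inj] at hcomm
  obtain ⟨-, hB, hC, -⟩ := hcomm
  have hB : B = 0 := by
    ext i j
    exact self_eq_neg.mp (by simpa using (congrFun₂ hB i j).symm)
  have hC : C = 0 := by
    ext i j
    exact self_eq_neg.mp (by simpa using congrFun₂ hC i j)
  subst hB hC
  rw [fromBlocks_transpose, fromBlocks_inj] at hsymm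
  rw [fromBlocks_conjTranspose, fromBlocks_multiply, ← fromBlocks_one,
    fromBlocks_inj] at hUstar
  refine ⟨A, D, mem_unitaryGroup_iff.mpr ?_, mem_unitaryGroup_iff.mpr ?_,
    hsymm.1, hsymm.2.2.2, rfl⟩
  · simpa [star_eq_conjTranspose] using hUstar.1
  · simpa [star_eq_conjTranspose] using hUstar.2.2.2
end

section
/- Let p, q be natural numbers, let γ be the (p+q)×(p+q) complex matrix given in block form by γ = diag(1_p, −1_q), and let J = U∘C be an antiunitary operator on ℂ^(p+q), where U is a unitary (p+q)×(p+q) complex matrix and C denotes entrywise complex conjugation. If J∘J = −id and J∘γ = −γ∘J (the case of KO-dimension 2, with signs ε = −1, ε'' = −1), then p = q and there exists a p×p matrix j with j·j* = j*·j = 1 such that U has the block form U = [[0, j], [−jᵀ, 0]]. -/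
open Matrix

/-- A unitary matrix `U` such that `U ∘ C` squares to `-id` is antisymmetric. -/
theorem transpose_eq_neg_of_unitary_of_mul_conj {n : Type*} [Fintype n] [DecidableEq n]
    {U : Matrix n n ℂ} (hU : U ∈ Matrix.unitaryGroup n ℂ) (h : U * Uᴴᵀ = -1) : Uᵀ = -U := by
  have h1 : Uᴴ * U = 1 := Matrix.mem_unitaryGroup_iff'.mp hU
  have h2 : Uᴴᵀ = -Uᴴ := by
    calc Uᴴᵀ = Uᴴ * U * Uᴴᵀ := by rw [h1, one_mul]
      _ = -Uᴴ := by rw [mul_assoc, h, mul_neg, mul_one]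
  have h3 := congrArg Matrix.conjTranspose h2
  rw [Matrix.conjTranspose_neg, Matrix.conjTranspose_conjTranspose] at h3
  rw [← h3]
  ext i j
  simp

/-- A complex matrix equal to its own negative is zero. -/
theorem eq_zero_of_eq_neg_self {m n : Type*} {A : Matrix m n ℂ} (h : A = -A) : A = 0 := by
  ext i j
  exact self_eq_neg.mp (congrFun (congrFun h i) j)

/-- A rectangular matrix with a two-sided inverse over `ℂ` is square. -/
theorem eq_of_mul_eq_one_of_mul_eq_one {p q : ℕ} {A : Matrix (Fin p) (Fin q) ℂ}
    {B : Matrix (Fin q) (Fin p) ℂ} (hAB : A * B = 1) (hBA : B * A = 1) : p = q := by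
  have h := Matrix.trace_mul_comm A B
  rw [hAB, hBA, Matrix.trace_one, Matrix.trace_one, Fintype.card_fin, Fintype.card_fin] at h
  exact_mod_cast h

/-- Lemma 2.1, KO-dimension 2 case: if `J = U ∘ C` is an antiunitary on `ℂ^(p+q)`
(with `U` unitary and `C` entrywise conjugation) satisfying `J² = -id` and `Jγ = -γJ`
for the grading `γ = diag(1_p, -1_q)`, then `p = q` and
`U = [[0, j], [-jᵀ, 0]]` with `j j* = j* j = 1`. -/
theorem two_point_real_structure_KO_dim_two (p q : ℕ)
    (U : Matrix (Fin p ⊕ Fin q) (Fin p ⊕ Fin q) ℂ)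
    (hU : U ∈ Matrix.unitaryGroup (Fin p ⊕ Fin q) ℂ)
    (γ : Matrix (Fin p ⊕ Fin q) (Fin p ⊕ Fin q) ℂ)
    (hγ : γ = Matrix.fromBlocks (1 : Matrix (Fin p) (Fin p) ℂ) 0 0
      (-1 : Matrix (Fin q) (Fin q) ℂ))
    (J : (Fin p ⊕ Fin q → ℂ) → (Fin p ⊕ Fin q → ℂ))
    (hJ : ∀ x, J x = U.mulVec (star x))
    (hJJ : ∀ x, J (J x) = -x)
    (hJγ : ∀ x, J (γ.mulVec x) = -(γ.mulVec (J x))) :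
    p = q ∧
    ∃ j : Matrix (Fin p) (Fin q) ℂ,
      j * j.conjTranspose = 1 ∧ j.conjTranspose * j = 1 ∧
      U = Matrix.fromBlocks 0 j (-j.transpose) 0 := by
  have hanti : Uᵀ = -U := by
    refine transpose_eq_neg_of_unitary_of_mul_conj hU (Matrix.ext_of_mulVec_single fun i => ?_)
    have h := hJJ (Pi.single i 1)
    rw [hJ, hJ, Matrix.star_mulVec, star_star, ← Matrix.mulVec_transpose,
      Matrix.mulVec_mulVec] at h
    rw [h, Matrix.neg_mulVec, Matrix.one_mulVec]
  have hγs : γᴴᵀ = γ := by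
    rw [hγ]
    simp [Matrix.fromBlocks_conjTranspose, Matrix.fromBlocks_transpose]
  have hcomm : U * γ = -(γ * U) := by
    refine Matrix.ext_of_mulVec_single fun i => ?_
    have h := hJγ (star (Pi.single i 1))
    rw [hJ, hJ, Matrix.star_mulVec, star_star, ← Matrix.mulVec_transpose, hγs,
      Matrix.mulVec_mulVec, Matrix.mulVec_mulVec] at h
    rw [h, Matrix.neg_mulVec]
  have hl : U * Uᴴ = 1 := Matrix.mem_unitaryGroup_iff.mp hU
  have hr : Uᴴ * U = 1 := Matrix.mem_unitaryGroup_iff'.mp hU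
  obtain ⟨A, B, C, D, rfl⟩ : ∃ A B C D, U = Matrix.fromBlocks A B C D :=
    ⟨_, _, _, _, (Matrix.fromBlocks_toBlocks U).symm⟩
  rw [hγ, Matrix.fromBlocks_multiply, Matrix.fromBlocks_multiply, Matrix.fromBlocks_neg,
    Matrix.fromBlocks_inj] at hcomm
  obtain ⟨hA, -, -, hD⟩ := hcomm
  replace hA : A = 0 := eq_zero_of_eq_neg_self (by simpa using hA)
  replace hD : D = 0 := eq_zero_of_eq_neg_self (Eq.symm (by simpa using hD))
  rw [Matrix.fromBlocks_transpose, Matrix.fromBlocks_neg, Matrix.fromBlocks_inj] at hanti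
  have hC : C = -Bᵀ := by rw [hanti.2.2.1, neg_neg]
  subst hA hD
  rw [Matrix.fromBlocks_conjTranspose, Matrix.fromBlocks_multiply, ← Matrix.fromBlocks_one,
    Matrix.fromBlocks_inj] at hl hr
  have hBl : B * Bᴴ = 1 := by simpa using hl.1
  have hBr : Bᴴ * B = 1 := by simpa using hr.2.2.2
  exact ⟨eq_of_mul_eq_one_of_mul_eq_one hBl hBr, B, hBl, hBr, by rw [hC]⟩
end

section
/- Let p, q be natural numbers, let γ be the (p+q)×(p+q) complex matrix given in block form by γ = diag(1_p, −1_q), and let J = U∘C be an antiunitary operator on ℂ^(p+q), where U is a unitary (p+q)×(p+q) complex matrix and C denotes entrywise complex conjugation. If J∘J = −id and J∘γ = γ∘J (the case of KO-dimension 4, with signs ε = −1, ε'' = 1), then U is block diagonal: there exist a unitary p×p matrix j₊ and a unitary q×q matrix j₋, both anti-symmetric (j₊ᵀ = −j₊ and j₋ᵀ = −j₋), such that U = diag(j₊, j₋). -/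
open Matrix

theorem Matrix.star_mulVec_eq_transpose_conjTranspose_mulVec {m n : Type*} [Fintype n]
    (A : Matrix m n ℂ) (x : n → ℂ) : star (A *ᵥ x) = Aᴴᵀ *ᵥ star x := by
  rw [star_mulVec, mulVec_transpose]

/-- A unitary `U` such that `U ∘ C` squares to `-id` is anti-symmetric. -/
theorem Matrix.transpose_eq_neg_of_conj_sq {n : Type*} [Fintype n] [DecidableEq n]
    {U : Matrix n n ℂ} (hU : U ∈ Matrix.unitaryGroup n ℂ)
    (h : ∀ x, U *ᵥ star (U *ᵥ star x) = -x) : Uᵀ = -U := by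
  have h_sq : U * Uᴴᵀ = -1 := by
    refine ext_of_mulVec_single fun i => ?_
    rw [← mulVec_mulVec, neg_mulVec, one_mulVec, ← h]
    rw [star_mulVec_eq_transpose_conjTranspose_mulVec, star_star]
  have h_left : Uᴴ * U = 1 := mem_unitaryGroup_iff'.mp hU
  have h_conj : Uᴴᵀ = -Uᴴ := by
    calc Uᴴᵀ = Uᴴ * (U * Uᴴᵀ) := by rw [← Matrix.mul_assoc, h_left, Matrix.one_mul]
      _ = -Uᴴ := by rw [h_sq, Matrix.mul_neg, Matrix.mul_one]
  ext i j
  simpa using congrArg star (congrFun (congrFun h_conj j) i)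

/-- A matrix commuting with the grading `diag(1, -1)` has vanishing off-diagonal blocks. -/
theorem Matrix.eq_fromBlocks_of_commute_grading {m n : Type*} [Fintype m] [Fintype n]
    [DecidableEq m] [DecidableEq n] {U : Matrix (m ⊕ n) (m ⊕ n) ℂ}
    (h : U * fromBlocks 1 0 0 (-1) = fromBlocks 1 0 0 (-1) * U) :
    U = fromBlocks U.toBlocks₁₁ 0 0 U.toBlocks₂₂ := by
  rw [← fromBlocks_toBlocks U, fromBlocks_multiply, fromBlocks_multiply, fromBlocks_inj] at h
  obtain ⟨-, h₁₂, h₂₁, -⟩ := h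
  have h_upper : U.toBlocks₁₂ = 0 := by
    ext i j
    simpa [neg_eq_self] using congrFun (congrFun h₁₂ i) j
  have h_lower : U.toBlocks₂₁ = 0 := by
    ext i j
    simpa [self_eq_neg] using congrFun (congrFun h₂₁ i) j
  conv_lhs => rw [← fromBlocks_toBlocks U, h_upper, h_lower]

/-- Lemma 2.1, KO-dimension 4 case: if `J = U ∘ C` is an antiunitary on `ℂ^(p+q)`
(with `U` unitary and `C` entrywise conjugation) satisfying `J² = -id` and `Jγ = γJ`
for the grading `γ = diag(1_p, -1_q)`, then `U = diag(j₊, j₋)` with `j₊, j₋`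
anti-symmetric unitary matrices. -/
theorem two_point_real_structure_KO_dim_four (p q : ℕ)
    (U : Matrix (Fin p ⊕ Fin q) (Fin p ⊕ Fin q) ℂ)
    (hU : U ∈ Matrix.unitaryGroup (Fin p ⊕ Fin q) ℂ)
    (γ : Matrix (Fin p ⊕ Fin q) (Fin p ⊕ Fin q) ℂ)
    (hγ : γ = Matrix.fromBlocks (1 : Matrix (Fin p) (Fin p) ℂ) 0 0
      (-1 : Matrix (Fin q) (Fin q) ℂ))
    (J : (Fin p ⊕ Fin q → ℂ) → (Fin p ⊕ Fin q → ℂ))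
    (hJ : ∀ x, J x = U.mulVec (star x))
    (hJJ : ∀ x, J (J x) = -x)
    (hJγ : ∀ x, J (γ.mulVec x) = γ.mulVec (J x)) :
    ∃ (jp : Matrix (Fin p) (Fin p) ℂ) (jm : Matrix (Fin q) (Fin q) ℂ),
      jp ∈ Matrix.unitaryGroup (Fin p) ℂ ∧ jm ∈ Matrix.unitaryGroup (Fin q) ℂ ∧
      jp.transpose = -jp ∧ jm.transpose = -jm ∧
      U = Matrix.fromBlocks jp 0 0 jm := by
  have h_anti : Uᵀ = -U := transpose_eq_neg_of_conj_sq hU fun x => by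
    rw [← hJ, ← hJ, hJJ]
  have h_star : γᴴᵀ = γ := by
    simp [hγ, fromBlocks_conjTranspose, fromBlocks_transpose]
  have h_comm : U * γ = γ * U := by
    refine ext_of_mulVec_single fun i => ?_
    have := hJγ (star (Pi.single i 1))
    rwa [hJ, hJ, star_mulVec_eq_transpose_conjTranspose_mulVec, h_star, star_star, mulVec_mulVec,
      mulVec_mulVec] at this
  rw [hγ] at h_comm
  have h_block := eq_fromBlocks_of_commute_grading h_comm
  have h_unit := mem_unitaryGroup_iff.mp hU
  rw [h_block, star_eq_conjTranspose, fromBlocks_conjTranspose, fromBlocks_multiply,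
    ← fromBlocks_one, fromBlocks_inj] at h_unit
  rw [h_block, fromBlocks_transpose, fromBlocks_neg, fromBlocks_inj] at h_anti
  refine ⟨U.toBlocks₁₁, U.toBlocks₂₂, ?_, ?_, h_anti.1, h_anti.2.2.2, h_block⟩
  · rw [mem_unitaryGroup_iff, star_eq_conjTranspose]
    simpa using h_unit.1
  · rw [mem_unitaryGroup_iff, star_eq_conjTranspose]
    simpa using h_unit.2.2.2
end

section
/- Let p, q be natural numbers, let γ be the (p+q)×(p+q) complex matrix given in block form by γ = diag(1_p, −1_q), and let J = U∘C be an antiunitary operator on ℂ^(p+q), where U is a unitary (p+q)×(p+q) complex matrix and C denotes entrywise complex conjugation. If J∘J = id and J∘γ = −γ∘J (the case of KO-dimension 6, with signs ε = 1, ε'' = −1), then p = q and there exists a p×p matrix j with j·j* = j*·j = 1 such that U has the block form U = [[0, j], [jᵀ, 0]]. -/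
open Matrix

/-- If `U` is unitary and `U ∘ C` is an involution, then `U` is symmetric. -/
theorem Matrix.transpose_eq_of_mulVec_star_involutive {n : Type*} [Fintype n] [DecidableEq n]
    {U : Matrix n n ℂ} (hU : U ∈ Matrix.unitaryGroup n ℂ)
    (h : ∀ x, U *ᵥ star (U *ᵥ star x) = x) : Uᵀ = U := by
  have key : U * Uᴴᵀ = 1 := by
    refine Matrix.ext_of_mulVec_single fun i => ?_
    have := h (Pi.single i 1)
    rw [star_mulVec, star_star, ← mulVec_transpose, mulVec_mulVec] at this
    rw [this, one_mulVec]
  have hinv : Uᴴ * U = 1 := mem_unitaryGroup_iff'.mp hU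
  have hconj : Uᴴᵀ = Uᴴ := by
    calc Uᴴᵀ = Uᴴ * U * Uᴴᵀ := by rw [hinv, one_mul]
      _ = Uᴴ := by rw [mul_assoc, key, mul_one]
  exact conjTranspose_injective (by rw [← hconj]; rfl)

/-- A matrix with a two-sided conjugate transpose inverse is square. -/
theorem Matrix.eq_of_mul_conjTranspose_eq_one {p q : ℕ} {B : Matrix (Fin p) (Fin q) ℂ}
    (h₁ : B * Bᴴ = 1) (h₂ : Bᴴ * B = 1) : p = q := by
  have h := trace_mul_comm B Bᴴ
  rw [h₁, h₂, trace_one, trace_one, Fintype.card_fin, Fintype.card_fin] at h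
  exact_mod_cast h

/-- Lemma 2.1, KO-dimension 6 case: if `J = U ∘ C` is an antiunitary on `ℂ^(p+q)`
(with `U` unitary and `C` entrywise conjugation) satisfying `J² = id` and `Jγ = -γJ`
for the grading `γ = diag(1_p, -1_q)`, then `p = q` and
`U = [[0, j], [jᵀ, 0]]` with `j j* = j* j = 1`. -/
theorem two_point_real_structure_KO_dim_six (p q : ℕ)
    (U : Matrix (Fin p ⊕ Fin q) (Fin p ⊕ Fin q) ℂ)
    (hU : U ∈ Matrix.unitaryGroup (Fin p ⊕ Fin q) ℂ)
    (γ : Matrix (Fin p ⊕ Fin q) (Fin p ⊕ Fin q) ℂ)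
    (hγ : γ = Matrix.fromBlocks (1 : Matrix (Fin p) (Fin p) ℂ) 0 0
      (-1 : Matrix (Fin q) (Fin q) ℂ))
    (J : (Fin p ⊕ Fin q → ℂ) → (Fin p ⊕ Fin q → ℂ))
    (hJ : ∀ x, J x = U.mulVec (star x))
    (hJJ : ∀ x, J (J x) = x)
    (hJγ : ∀ x, J (γ.mulVec x) = -(γ.mulVec (J x))) :
    p = q ∧
    ∃ j : Matrix (Fin p) (Fin q) ℂ,
      j * j.conjTranspose = 1 ∧ j.conjTranspose * j = 1 ∧
      U = Matrix.fromBlocks 0 j j.transpose 0 := by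
  have hsymm : Uᵀ = U := transpose_eq_of_mulVec_star_involutive hU fun x => by
    simpa only [hJ] using hJJ x
  have hanti : U * γ = -(γ * U) := by
    have hγs : γᴴᵀ = γ := by
      simp [hγ, fromBlocks_conjTranspose, fromBlocks_transpose]
    refine Matrix.ext_of_mulVec_single fun i => ?_
    have h := hJγ (star (Pi.single i 1))
    rw [hJ, hJ, star_mulVec, star_star, ← mulVec_transpose, hγs, mulVec_mulVec,
      mulVec_mulVec] at h
    rw [h, neg_mulVec]
  obtain ⟨A, B, C, D, rfl⟩ : ∃ A B C D, U = fromBlocks A B C D :=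
    ⟨_, _, _, _, (fromBlocks_toBlocks U).symm⟩
  subst hγ
  simp only [fromBlocks_multiply, fromBlocks_neg, fromBlocks_inj, Matrix.mul_zero,
    Matrix.zero_mul, Matrix.mul_one, Matrix.one_mul, Matrix.mul_neg, Matrix.neg_mul, add_zero, zero_add, neg_neg] at hanti
  obtain ⟨hA, -, -, hD⟩ := hanti
  obtain rfl : A = 0 := Matrix.ext fun i j => self_eq_neg.mp (congrFun₂ hA i j)
  obtain rfl : D = 0 := Matrix.ext fun i j => self_eq_neg.mp (congrFun₂ hD.symm i j)
  rw [fromBlocks_transpose, fromBlocks_inj] at hsymm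
  obtain ⟨-, -, rfl, -⟩ := hsymm
  have h₁ := mem_unitaryGroup_iff.mp hU
  have h₂ := mem_unitaryGroup_iff'.mp hU
  rw [star_eq_conjTranspose, fromBlocks_conjTranspose, fromBlocks_multiply, ← fromBlocks_one,
    fromBlocks_inj] at h₁ h₂
  have hB₁ : B * Bᴴ = 1 := by simpa using h₁.1
  have hB₂ : Bᴴ * B = 1 := by simpa using h₂.2.2.2
  exact ⟨eq_of_mul_conjTranspose_eq_one hB₁ hB₂, B, hB₁, hB₂, rfl⟩
end

section
/- Let γ = diag(1, −1) as a 2×2 complex matrix, let t ∈ ℂ, and let D be the 2×2 self-adjoint matrix with entries D₁₁ = D₂₂ = 0, D₁₂ = t, D₂₁ = conj(t). Let A = { diag(a₁, a₂) : a₁, a₂ ∈ ℂ } be the algebra of diagonal 2×2 complex matrices acting on ℂ². Suppose J is an antiunitary operator on ℂ² satisfying J ∘ γ = ε''·(γ ∘ J) for some sign ε'' ∈ {1, −1}, and suppose the order-one condition holds: [[D, a], J b* J⁻¹] = 0 for all a, b ∈ A (where J b* J⁻¹ denotes the linear map ξ ↦ J(b*(J⁻¹ ξ))). Then t = 0, i.e.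 D = 0. -/
open Matrix

/-- Proposition 3.1: the even finite spectral triple of the two-point space, with
algebra `ℂ²` acting diagonally on `ℂ²`, grading `γ = diag(1, -1)` and off-diagonal
self-adjoint Dirac operator `D = [[0, t], [conj t, 0]]`, can only admit a real
structure (an antiunitary `J` with `Jγ = ±γJ` satisfying the order-one condition)
if `D = 0`, i.e. `t = 0`. -/
theorem two_point_space_real_structure_implies_zero_Dirac (t : ℂ)
    (D γ : Matrix (Fin 2) (Fin 2) ℂ)
    (hD : D = !![0, t; starRingEnd ℂ t, 0])
    (hγ : γ = Matrix.diagonal ![1, -1])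
    (J Jinv : (Fin 2 → ℂ) → (Fin 2 → ℂ))
    -- `J` is antiunitary
    (hadd : ∀ x y, J (x + y) = J x + J y)
    (hsmul : ∀ (c : ℂ) (x : Fin 2 → ℂ), J (c • x) = (starRingEnd ℂ c) • J x)
    (hbij : Function.Bijective J)
    (hinner : ∀ x y : Fin 2 → ℂ, star (J x) ⬝ᵥ J y = star y ⬝ᵥ x)
    (hJinv1 : Function.LeftInverse Jinv J)
    (hJinv2 : Function.RightInverse Jinv J)
    -- `J γ = ε'' γ J` for a sign `ε''`
    (ε'' : ℂ) (hε'' : ε'' = 1 ∨ ε'' = -1)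
    (hJγ : ∀ x, J (γ.mulVec x) = ε'' • γ.mulVec (J x))
    -- the order-one condition `[[D, a], J b* J⁻¹] = 0` for all diagonal `a, b`
    (h1 : ∀ a₁ a₂ b₁ b₂ : ℂ, ∀ ξ : Fin 2 → ℂ,
      (D * Matrix.diagonal ![a₁, a₂] - Matrix.diagonal ![a₁, a₂] * D).mulVec
          (J ((star (Matrix.diagonal ![b₁, b₂])).mulVec (Jinv ξ))) =
        J ((star (Matrix.diagonal ![b₁, b₂])).mulVec (Jinv
          ((D * Matrix.diagonal ![a₁, a₂] - Matrix.diagonal ![a₁, a₂] * D).mulVec ξ)))) :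
    t = 0 := by
  have conj_γ (x : Fin 2 → ℂ) :
      J ((star (Matrix.diagonal ![1, -1])).mulVec (Jinv x)) = ε'' • γ.mulVec x := by
    have hstar : star (Matrix.diagonal ![(1 : ℂ), -1]) = γ := by
      subst hγ
      ext i j
      fin_cases i <;> fin_cases j <;> simp
    rw [hstar, hJγ, hJinv2 x]
  have h := congrFun (h1 0 1 1 (-1) ![0, 1]) 0
  rw [conj_γ, conj_γ, hD, hγ] at h
  have hε : ε'' ≠ 0 := by
    rcases hε'' with rfl | rfl <;> norm_num
  simp [Matrix.mulVec, Matrix.vecMul, dotProduct, Fin.sum_univ_two, Matrix.mul_apply,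
    Matrix.diagonal_apply] at h
  have hεt : ε'' * t = 0 := by linear_combination (-1 / 2) * h
  exact (mul_eq_zero.mp hεt).resolve_left hε
end

section
/- Let γ_F = diag(1, −1, −1, 1) as a 4×4 complex matrix, let J_F be the antiunitary operator on ℂ⁴ defined by J_F(z₁, z₂, z₃, z₄) = (conj(z₃), conj(z₄), conj(z₁), conj(z₂)) (so J_F² = id), and let A = { diag(a₁, a₁, a₂, a₂) : a₁, a₂ ∈ ℂ } ⊆ M₄(ℂ). Suppose D is a self-adjoint 4×4 complex matrix satisfying: (i) D·γ_F = −γ_F·D; (ii) D ∘ J_F = J_F ∘ D as maps on ℂ⁴; and (iii) the order-one condition [[D, a], J_F b* J_F] = 0 for all a, b ∈ A, where J_F b* J_F denotes the linear map ξ ↦ J_F(b*(J_F ξ)). Then there exists d ∈ ℂ such that D has entries D₁₂ = d, D₂₁ = conj(d), D₃₄ = conj(d), D₄₃ = d, and all other entries zero. -/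
open Matrix

/-- Classification of finite Dirac operators for the electrodynamics finite spectral
triple `F_ED`: a self-adjoint `4×4` matrix `D` anticommuting with the grading
`γ_F = diag(1, -1, -1, 1)`, commuting with the real structure
`J_F(z₁, z₂, z₃, z₄) = (conj z₃, conj z₄, conj z₁, conj z₂)`, and satisfying the
order-one condition for the algebra `{ diag(a₁, a₁, a₂, a₂) }`, is of the form
`D₁₂ = d`, `D₂₁ = conj d`, `D₃₄ = conj d`, `D₄₃ = d`, all other entries zero. -/
theorem electrodynamics_finite_Dirac_classification
    (γF : Matrix (Fin 4) (Fin 4) ℂ)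
    (hγF : γF = Matrix.diagonal ![1, -1, -1, 1])
    (J : (Fin 4 → ℂ) → (Fin 4 → ℂ))
    (hJ : ∀ z, J z = ![starRingEnd ℂ (z 2), starRingEnd ℂ (z 3),
      starRingEnd ℂ (z 0), starRingEnd ℂ (z 1)])
    (D : Matrix (Fin 4) (Fin 4) ℂ)
    (hsa : D.IsHermitian)
    (hDγ : D * γF = -(γF * D))
    (hDJ : ∀ z, D.mulVec (J z) = J (D.mulVec z))
    (h1 : ∀ a₁ a₂ b₁ b₂ : ℂ, ∀ ξ : Fin 4 → ℂ,
      (D * Matrix.diagonal ![a₁, a₁, a₂, a₂] -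
          Matrix.diagonal ![a₁, a₁, a₂, a₂] * D).mulVec
          (J ((star (Matrix.diagonal ![b₁, b₁, b₂, b₂])).mulVec (J ξ))) =
        J ((star (Matrix.diagonal ![b₁, b₁, b₂, b₂])).mulVec (J
          ((D * Matrix.diagonal ![a₁, a₁, a₂, a₂] -
            Matrix.diagonal ![a₁, a₁, a₂, a₂] * D).mulVec ξ)))) :
    ∃ d : ℂ, D = !![0, d, 0, 0;
                    starRingEnd ℂ d, 0, 0, 0;
                    0, 0, 0, starRingEnd ℂ d;
                    0, 0, d, 0] := by
  have anti (i j : Fin 4) := congr_fun (congr_fun hDγ i) j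
  have order (i j : Fin 4) := congr_fun (h1 0 1 0 1 (Pi.single j 1)) i
  have real (i j : Fin 4) := congr_fun (hDJ (Pi.single j 1)) i
  have herm (i j : Fin 4) : D i j = starRingEnd ℂ (D j i) := (hsa.apply i j).symm
  simp only [hγF, Matrix.neg_apply, mul_diagonal, diagonal_mul] at anti
  have h02 : D 0 2 = 0 := by
    simpa [hJ, mulVec, dotProduct, Fin.sum_univ_four, star_eq_conjTranspose,
      diagonal_conjTranspose, diagonal_apply] using (order 0 2).symm
  have h13 : D 1 3 = 0 := by
    simpa [hJ, mulVec, dotProduct, Fin.sum_univ_four, star_eq_conjTranspose,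
      diagonal_conjTranspose, diagonal_apply] using (order 1 3).symm
  have h23 : D 2 3 = starRingEnd ℂ (D 0 1) := by
    simpa [hJ, mulVec, dotProduct, Fin.sum_univ_four] using real 2 1
  have h00 : D 0 0 = 0 := self_eq_neg.mp (by simpa using anti 0 0)
  have h11 : D 1 1 = 0 := self_eq_neg.mp (by simpa using (anti 1 1).symm)
  have h22 : D 2 2 = 0 := self_eq_neg.mp (by simpa using (anti 2 2).symm)
  have h33 : D 3 3 = 0 := self_eq_neg.mp (by simpa using anti 3 3)
  have h03 : D 0 3 = 0 := self_eq_neg.mp (by simpa using anti 0 3)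
  have h12 : D 1 2 = 0 := self_eq_neg.mp (by simpa using (anti 1 2).symm)
  refine ⟨D 0 1, ?_⟩
  ext i j
  fin_cases i <;> fin_cases j <;>
    simp [h00, h11, h22, h33, h02, h13, h03, h12, h23, herm 1 0, herm 2 0, herm 3 0,
      herm 2 1, herm 3 1, herm 3 2]
end
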